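/- Let Φ={φ_i}_{i∈Λ} be an analytic IFS on I=[0,1] with 0<|φ_i'(x)|<1 for all i∈Λ and x∈I, whose maps have no common fixed point, and let p be a positive probability vector with self-conformal measure μ, Bernoulli measure β=p^ℕ on Λ^ℕ, and Lyapunov exponent χ. Then for β-a.e. ω∈Λ^ℕ, lim_{n→∞} (1/n) H( (Π_nβ_ω).μ, D_{χn} ) = 0, where β_ω is the disintegration of β with respect to Π^{-1} of the Borel σ-algebra of ℝ, and (Π_nβ_ω).μ is the pushforward of β_ω×μ under (η,x)↦φ_{η|_n}(x). -/

import Mathlib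

open MeasureTheory Filter Set Metric Topology

noncomputable section

/-- The unit interval `I = [0,1]`. -/
def unitI : Set ℝ := Set.Icc 0 1

/-- For a word `u = i₁…iₙ`, `compWord φ u = φ_{i₁} ∘ … ∘ φ_{iₙ}`. -/
def compWord {Λ : Type*} (φ : Λ → ℝ → ℝ) : List Λ → ℝ → ℝ
  | [] => id
  | i :: u => φ i ∘ compWord φ u

/-- `μ` is exact dimensional with dimension `d`. -/
def ExactDimWith (μ : Measure ℝ) (d : ℝ) : Prop :=
  ∀ᵐ x ∂μ, Tendsto (fun δ : ℝ =>
      Real.log (μ (Metric.closedBall x δ)).toReal / Real.log δ)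
    (nhdsWithin 0 (Set.Ioi 0)) (nhds d)

/-- The level-`n` dyadic interval `[m/2^n, (m+1)/2^n)`. -/
def dyadIco (n : ℕ) (m : ℤ) : Set ℝ :=
  Set.Ico ((m : ℝ) / 2 ^ n) (((m : ℝ) + 1) / 2 ^ n)

/-- Entropy of a measure on `ℝ` with respect to the level-`n` dyadic partition
(logarithms in base 2). -/
def ent1 (n : ℕ) (θ : Measure ℝ) : ℝ :=
  -∑' m : ℤ, (θ (dyadIco n m)).toReal * Real.logb 2 (θ (dyadIco n m)).toReal

/-- The level-`n` dyadic cell containing `x`. -/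
def dcell (n : ℕ) (x : ℝ) : Set ℝ := dyadIco n ⌊x * 2 ^ n⌋

/-- The level-`n` component `θ_{x,n}`: `θ` conditioned on the dyadic cell of `x`. -/
def dcomp (θ : Measure ℝ) (x : ℝ) (n : ℕ) : Measure ℝ :=
  (θ (dcell n x))⁻¹ • θ.restrict (dcell n x)

/-- A finite family of contractions of `I` with log-derivatives `ℓ i` of bounded distortion. -/
structure BoundedDistortion {Λ : Type*} (φ ℓ : Λ → ℝ → ℝ) (ρ K : ℝ) : Prop where
  mapsTo : ∀ i, MapsTo (φ i) unitI unitI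
  cont : ∀ i, ContinuousOn (φ i) unitI
  logCont : ∀ i, ContinuousOn (ℓ i) unitI
  rate_nonneg : 0 ≤ ρ
  rate_lt_one : ρ < 1
  lip_nonneg : 0 ≤ K
  contract : ∀ i, ∀ a ∈ unitI, ∀ b ∈ unitI, |φ i a - φ i b| ≤ ρ * |a - b|
  logLip : ∀ i, ∀ a ∈ unitI, ∀ b ∈ unitI, |ℓ i a - ℓ i b| ≤ K * |a - b|
  distort : ∀ i, ∀ a ∈ unitI, ∀ b ∈ unitI,
    |φ i a - φ i b| ≤ Real.exp (ℓ i a + K * |a - b|) * |a - b|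

lemma exists_boundedDistortion {Λ : Type*} [Finite Λ] (φ : Λ → ℝ → ℝ)
    (hanal : ∀ i, AnalyticOnNhd ℝ (φ i) unitI)
    (hmaps : ∀ i, MapsTo (φ i) unitI unitI)
    (hderiv : ∀ i, ∀ x ∈ unitI, 0 < |deriv (φ i) x| ∧ |deriv (φ i) x| < 1) :
    ∃ ρ K, BoundedDistortion φ (fun i x => Real.log |deriv (φ i) x|) ρ K := by
  have hI : IsCompact unitI := isCompact_Icc
  have hconv : Convex ℝ unitI := convex_Icc 0 1
  have hne : unitI.Nonempty := ⟨0, by simp [unitI]⟩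
  have hrate : ∀ i, ∃ r < 1, ∀ x ∈ unitI, |deriv (φ i) x| ≤ r := fun i => by
    obtain ⟨x, hx, hmax⟩ := hI.exists_isMaxOn hne (hanal i).deriv.continuousOn.abs
    exact ⟨_, (hderiv i x hx).2, fun y hy => hmax hy⟩
  have hC1 : ∀ i, ContDiffOn ℝ 1 (fun x => Real.log |deriv (φ i) x|) unitI := fun i x hx => by
    simp only [Real.log_abs]
    exact (((hanal i).deriv x hx).contDiffAt.log (abs_pos.1 (hderiv i x hx).1)).contDiffWithinAt
  have hlip := fun i => (hC1 i).exists_lipschitzOnWith one_ne_zero hconv hI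
  choose r hr1 hr using hrate
  choose L hL using hlip
  have h₁ : ∀ᶠ ρ in 𝓝[<] (1 : ℝ), 0 ≤ ρ ∧ ρ < 1 ∧ ∀ i, r i ≤ ρ := by
    refine (eventually_nhdsWithin_of_eventually_nhds (eventually_ge_nhds one_pos)).and
      (eventually_mem_nhdsWithin.and (eventually_all.2 fun i => ?_))
    exact eventually_nhdsWithin_of_eventually_nhds (eventually_ge_nhds (hr1 i))
  have h₂ : ∀ᶠ K in (atTop : Filter ℝ), 0 ≤ K ∧ ∀ i, (L i : ℝ) ≤ K :=
    (eventually_ge_atTop 0).and (eventually_all.2 fun i => eventually_ge_atTop _)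
  obtain ⟨ρ, hρ0, hρ1, hρ⟩ := h₁.exists
  obtain ⟨K, hK0, hK⟩ := h₂.exists
  have hlogLip : ∀ i, ∀ a ∈ unitI, ∀ b ∈ unitI,
      |Real.log (|deriv (φ i) a|) - Real.log (|deriv (φ i) b|)| ≤ K * |a - b| := fun i a ha b hb => by
    have := (hL i).dist_le_mul a ha b hb
    rw [Real.dist_eq, Real.dist_eq] at this
    exact this.trans (mul_le_mul_of_nonneg_right (hK i) (abs_nonneg _))
  refine ⟨ρ, K, hmaps, fun i => (hanal i).continuousOn, fun i => (hC1 i).continuousOn, hρ0, hρ1,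
    hK0, fun i a ha b hb => ?_, hlogLip, fun i a ha b hb => ?_⟩
  · exact hconv.norm_image_sub_le_of_norm_deriv_le
      (fun x hx => (hanal i x hx).differentiableAt) (fun x hx => (hr i x hx).trans (hρ i)) hb ha
  · have hsub : uIcc a b ⊆ unitI := Set.ordConnected_Icc.uIcc_subset ha hb
    refine (convex_uIcc a b).norm_image_sub_le_of_norm_deriv_le
      (fun x hx => (hanal i x (hsub hx)).differentiableAt) (fun x hx => ?_)
      right_mem_uIcc left_mem_uIcc
    rw [Real.norm_eq_abs, ← Real.exp_log (hderiv i x (hsub hx)).1]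
    apply Real.exp_le_exp.2
    have h₃ := (abs_le.1 (hlogLip i a ha x (hsub hx))).1
    have h₄ : K * |(a - x : ℝ)| ≤ K * |(a - b : ℝ)| := by
      rw [abs_sub_comm a x, abs_sub_comm a b]
      exact mul_le_mul_of_nonneg_left (abs_sub_left_of_mem_uIcc hx) hK0
    linarith

/-- The logarithm of the derivative of `compWord φ u` at `y`, as a sum along the word. -/
def logDerivWord {Λ : Type*} (φ ℓ : Λ → ℝ → ℝ) : List Λ → ℝ → ℝ
  | [], _ => 0
  | i :: u, y => ℓ i (compWord φ u y) + logDerivWord φ ℓ u y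

lemma compWord_append {Λ : Type*} (φ : Λ → ℝ → ℝ) (u v : List Λ) (y : ℝ) :
    compWord φ (u ++ v) y = compWord φ u (compWord φ v y) := by
  induction u with
  | nil => rfl
  | cons i u ih => simp [compWord, ih]

namespace BoundedDistortion

variable {Λ : Type*} {φ ℓ : Λ → ℝ → ℝ} {ρ K : ℝ}

lemma compWord_mem (h : BoundedDistortion φ ℓ ρ K) (u : List Λ) {y : ℝ} (hy : y ∈ unitI) :
    compWord φ u y ∈ unitI := by
  induction u with
  | nil => exact hy
  | cons i u ih => exact h.mapsTo i ih

lemma continuousOn_compWord (h : BoundedDistortion φ ℓ ρ K) (u : List Λ) :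
    ContinuousOn (compWord φ u) unitI := by
  induction u with
  | nil => exact continuousOn_id
  | cons i u ih => exact (h.cont i).comp ih fun y hy => h.compWord_mem u hy

lemma continuousOn_logDerivWord (h : BoundedDistortion φ ℓ ρ K) (u : List Λ) :
    ContinuousOn (logDerivWord φ ℓ u) unitI := by
  induction u with
  | nil => exact continuousOn_const
  | cons i u ih =>
    exact ((h.logCont i).comp (h.continuousOn_compWord u) fun y hy => h.compWord_mem u hy).add ih

lemma abs_compWord_sub_le (h : BoundedDistortion φ ℓ ρ K) (u : List Λ) {y z : ℝ}
    (hy : y ∈ unitI) (hz : z ∈ unitI) :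
    |compWord φ u y - compWord φ u z| ≤ ρ ^ u.length * |y - z| := by
  induction u with
  | nil => simp [compWord]
  | cons i u ih =>
    refine (h.contract i _ (h.compWord_mem u hy) _ (h.compWord_mem u hz)).trans ?_
    rw [List.length_cons, pow_succ', mul_assoc]
    exact mul_le_mul_of_nonneg_left ih h.rate_nonneg

lemma abs_sub_le_one {y z : ℝ} (hy : y ∈ unitI) (hz : z ∈ unitI) : |y - z| ≤ 1 := by
  rw [abs_le]
  constructor <;> linarith [hy.1, hy.2, hz.1, hz.2]

lemma abs_compWord_sub_le_pow (h : BoundedDistortion φ ℓ ρ K) (u : List Λ) {y z : ℝ}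
    (hy : y ∈ unitI) (hz : z ∈ unitI) :
    |compWord φ u y - compWord φ u z| ≤ ρ ^ u.length :=
  (h.abs_compWord_sub_le u hy hz).trans
    (mul_le_of_le_one_right (pow_nonneg h.rate_nonneg _) (abs_sub_le_one hy hz))

lemma sum_pow_le (h : BoundedDistortion φ ℓ ρ K) (n : ℕ) :
    K * ∑ j ∈ Finset.range n, ρ ^ j ≤ K / (1 - ρ) := by
  have h₁ : 0 < 1 - ρ := sub_pos.2 h.rate_lt_one
  rw [div_eq_mul_inv]
  refine mul_le_mul_of_nonneg_left ?_ h.lip_nonneg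
  rw [← tsum_geometric_of_lt_one h.rate_nonneg h.rate_lt_one]
  exact (summable_geometric_of_lt_one h.rate_nonneg h.rate_lt_one).sum_le_tsum _
    fun j _ => pow_nonneg h.rate_nonneg j

lemma abs_logDerivWord_sub_le (h : BoundedDistortion φ ℓ ρ K) (u : List Λ) {y z : ℝ}
    (hy : y ∈ unitI) (hz : z ∈ unitI) :
    |logDerivWord φ ℓ u y - logDerivWord φ ℓ u z| ≤ K / (1 - ρ) := by
  refine le_trans ?_ (h.sum_pow_le u.length)
  induction u with
  | nil => simp [logDerivWord]
  | cons i u ih =>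
    have h₁ := (h.logLip i _ (h.compWord_mem u hy) _ (h.compWord_mem u hz)).trans
      (mul_le_mul_of_nonneg_left (h.abs_compWord_sub_le_pow u hy hz) h.lip_nonneg)
    rw [List.length_cons, Finset.sum_range_succ, mul_add]
    rw [abs_le] at *
    simp only [logDerivWord]
    constructor <;> linarith [h₁.1, h₁.2, ih.1, ih.2]

lemma abs_compWord_sub_le_exp (h : BoundedDistortion φ ℓ ρ K) (u : List Λ) {y z : ℝ}
    (hy : y ∈ unitI) (hz : z ∈ unitI) :
    |compWord φ u y - compWord φ u z| ≤
      Real.exp (logDerivWord φ ℓ u y + K / (1 - ρ)) * |y - z| := by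
  refine le_trans ?_ (mul_le_mul_of_nonneg_right
    (Real.exp_le_exp.2 (add_le_add_right (h.sum_pow_le u.length) _)) (abs_nonneg _))
  induction u with
  | nil => simp [compWord, logDerivWord]
  | cons i u ih =>
    refine (h.distort i _ (h.compWord_mem u hy) _ (h.compWord_mem u hz)).trans ?_
    refine (mul_le_mul (Real.exp_le_exp.2 (add_le_add_right (mul_le_mul_of_nonneg_left
      (h.abs_compWord_sub_le_pow u hy hz) h.lip_nonneg) _)) ih (abs_nonneg _)
      (Real.exp_pos _).le).trans (le_of_eq ?_)
    rw [← mul_assoc, ← Real.exp_add, List.length_cons, Finset.sum_range_succ]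
    simp only [logDerivWord]
    ring_nf

lemma integrable_of_continuousOn {f : ℝ → ℝ} (hf : ContinuousOn f unitI) {μ : Measure ℝ}
    [IsFiniteMeasure μ] (hμI : μ unitIᶜ = 0) : Integrable f μ := by
  have : IntegrableOn f unitI μ := hf.integrableOn_compact isCompact_Icc
  rwa [IntegrableOn, Measure.restrict_eq_self_of_ae_mem (s := unitI) hμI] at this

lemma aemeasurable_of_continuousOn {f : ℝ → ℝ} (hf : ContinuousOn f unitI) {μ : Measure ℝ}
    (hμI : μ unitIᶜ = 0) : AEMeasurable f μ := by
  have := hf.aemeasurable (μ := μ) measurableSet_Icc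
  rwa [Measure.restrict_eq_self_of_ae_mem (s := unitI) hμI] at this

/-- The Lipschitz constant of `compWord φ u` is controlled by its mean log-derivative. -/
lemma abs_compWord_sub_le_exp_integral (h : BoundedDistortion φ ℓ ρ K) {μ : Measure ℝ}
    [IsProbabilityMeasure μ] (hμI : μ unitIᶜ = 0) (u : List Λ) {y z : ℝ}
    (hy : y ∈ unitI) (hz : z ∈ unitI) :
    |compWord φ u y - compWord φ u z| ≤
      Real.exp (∫ w, logDerivWord φ ℓ u w ∂μ + 2 * (K / (1 - ρ))) * |y - z| := by
  refine (h.abs_compWord_sub_le_exp u hy hz).trans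
    (mul_le_mul_of_nonneg_right (Real.exp_le_exp.2 ?_) (abs_nonneg _))
  have hint := integrable_of_continuousOn (h.continuousOn_logDerivWord u) hμI
  have h₁ : ∫ _, (logDerivWord φ ℓ u y - K / (1 - ρ)) ∂μ ≤ ∫ w, logDerivWord φ ℓ u w ∂μ := by
    refine integral_mono_ae (integrable_const _) hint ?_
    have hI : ∀ᵐ w ∂μ, w ∈ unitI := hμI
    filter_upwards [hI] with w hw
    linarith [(abs_le.1 (h.abs_logDerivWord_sub_le u hy hw)).2]
  rw [integral_const, probReal_univ, one_smul] at h₁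
  linarith

end BoundedDistortion

lemma sum_fin_succ_arrow {Λ : Type*} [Fintype Λ] {m : ℕ} (F : (Fin (m + 1) → Λ) → ℝ) :
    ∑ u, F u = ∑ i, ∑ v : Fin m → Λ, F (Fin.cons i v) := by
  classical
  rw [← (Fin.consEquiv fun _ => Λ).sum_comp F, Fintype.sum_prod_type]
  rfl

section Stationary

variable {Λ : Type*} [Fintype Λ] {φ ℓ : Λ → ℝ → ℝ} {ρ K : ℝ} {p : Λ → ℝ} {μ : Measure ℝ}
  [IsProbabilityMeasure μ]

lemma integral_stationary (h : BoundedDistortion φ ℓ ρ K) (hp : ∀ i, 0 < p i)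
    (hμI : μ unitIᶜ = 0)
    (hμ : μ = ∑ i : Λ, ENNReal.ofReal (p i) • Measure.map (φ i) μ)
    {f : ℝ → ℝ} (hf : ContinuousOn f unitI) :
    ∑ i, p i * ∫ w, f (φ i w) ∂μ = ∫ w, f w ∂μ := by
  have hφ : ∀ i, AEMeasurable (φ i) μ := fun i =>
    BoundedDistortion.aemeasurable_of_continuousOn (h.cont i) hμI
  have hmapI : ∀ i, Measure.map (φ i) μ unitIᶜ = 0 := fun i => by
    rw [Measure.map_apply_of_aemeasurable (hφ i) (by exact measurableSet_Icc.compl : MeasurableSet unitIᶜ)]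
    exact measure_mono_null (fun w hw hwI => hw (h.mapsTo i hwI)) hμI
  have hint : ∀ i, Integrable f (Measure.map (φ i) μ) := fun i =>
    BoundedDistortion.integrable_of_continuousOn hf (hmapI i)
  calc ∑ i, p i * ∫ w, f (φ i w) ∂μ
      = ∫ w, f w ∂(∑ i : Λ, ENNReal.ofReal (p i) • Measure.map (φ i) μ) := by
        rw [integral_finsetSum_measure
          fun i _ => (hint i).smul_measure ENNReal.ofReal_ne_top]
        refine Finset.sum_congr rfl fun i _ => ?_
        rw [integral_smul_measure, ENNReal.toReal_ofReal (hp i).le, smul_eq_mul,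
          integral_map (hφ i) (hint i).aestronglyMeasurable]
    _ = ∫ w, f w ∂μ := by rw [← hμ]

lemma sum_integral_compWord (h : BoundedDistortion φ ℓ ρ K) (hp : ∀ i, 0 < p i)
    (hμI : μ unitIᶜ = 0)
    (hμ : μ = ∑ i : Λ, ENNReal.ofReal (p i) • Measure.map (φ i) μ)
    (m : ℕ) {f : ℝ → ℝ} (hf : ContinuousOn f unitI) :
    ∑ u : Fin m → Λ, (∏ j, p (u j)) * ∫ w, f (compWord φ (List.ofFn u) w) ∂μ =
      ∫ w, f w ∂μ := by
  induction m generalizing f with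
  | zero => simp [compWord]
  | succ m ih =>
    rw [sum_fin_succ_arrow, ← integral_stationary h hp hμI hμ hf]
    refine Finset.sum_congr rfl fun i _ => ?_
    have hi := ih (f := fun w => f (φ i w)) (hf.comp (h.cont i) (h.mapsTo i))
    rw [← hi, Finset.mul_sum]
    refine Finset.sum_congr rfl fun v _ => ?_
    simp only [Fin.prod_univ_succ, Fin.cons_zero, Fin.cons_succ, List.ofFn_succ, compWord,
      Function.comp_apply, mul_assoc]

lemma sum_integral_logDerivWord (h : BoundedDistortion φ ℓ ρ K) (hp : ∀ i, 0 < p i)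
    (hp1 : ∑ i, p i = 1) (hμI : μ unitIᶜ = 0)
    (hμ : μ = ∑ i : Λ, ENNReal.ofReal (p i) • Measure.map (φ i) μ) (m : ℕ) :
    ∑ u : Fin m → Λ, (∏ j, p (u j)) * ∫ w, logDerivWord φ ℓ (List.ofFn u) w ∂μ =
      m * ∑ i, p i * ∫ w, ℓ i w ∂μ := by
  induction m with
  | zero => simp [logDerivWord]
  | succ m ih =>
    have hstep : ∀ i, ∑ v : Fin m → Λ, (∏ j, p ((Fin.cons i v : Fin (m + 1) → Λ) j)) *
        ∫ w, logDerivWord φ ℓ (List.ofFn (Fin.cons i v : Fin (m + 1) → Λ)) w ∂μ =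
        p i * ∫ w, ℓ i w ∂μ + p i * (m * ∑ i, p i * ∫ w, ℓ i w ∂μ) := fun i => by
      rw [← ih, ← sum_integral_compWord h hp hμI hμ m (h.logCont i), Finset.mul_sum,
        Finset.mul_sum, ← Finset.sum_add_distrib]
      refine Finset.sum_congr rfl fun v _ => ?_
      simp only [Fin.prod_univ_succ, Fin.cons_zero, Fin.cons_succ, List.ofFn_succ, logDerivWord]
      rw [integral_add (f := fun w => ℓ i (compWord φ (List.ofFn v) w))
        (BoundedDistortion.integrable_of_continuousOn ((h.logCont i).comp
          (h.continuousOn_compWord _) fun y hy => h.compWord_mem _ hy) hμI)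
        (BoundedDistortion.integrable_of_continuousOn (h.continuousOn_logDerivWord _) hμI)]
      ring
    rw [sum_fin_succ_arrow, Finset.sum_congr rfl fun i _ => hstep i, Finset.sum_add_distrib,
      ← Finset.sum_mul, hp1]
    push_cast
    ring

end Stationary

/-- The word `ω_a … ω_{a+n-1}`. -/
def window {Λ : Type*} (ω : ℕ → Λ) (a n : ℕ) : List Λ :=
  List.ofFn fun j : Fin n => ω (a + j)

lemma window_append {Λ : Type*} (ω : ℕ → Λ) (a m n : ℕ) :
    window ω a (m + n) = window ω a m ++ window ω (a + m) n := by
  have hw : ∀ a n, window ω a n = (List.range n).map fun j => ω (a + j) := fun a n => by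
    refine List.ext_getElem (by simp [window]) fun k _ _ => by simp [window]
  simp only [hw, List.range_add, List.map_append, List.map_map]
  congr 2
  funext j
  simp [add_assoc]

lemma bernoulli_coord {Λ : Type*} [MeasurableSpace Λ] [MeasurableSingletonClass Λ]
    {p : Λ → ℝ} {β : Measure (ℕ → Λ)} (hβ : ∀ n : ℕ, ∀ u : Fin n → Λ,
      β {ω | ∀ j : Fin n, ω (j : ℕ) = u j} = ∏ j : Fin n, ENNReal.ofReal (p (u j))) (i : Λ) :
    β.map (fun ω => ω 0) {i} = ENNReal.ofReal (p i) := by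
  rw [Measure.map_apply (measurable_pi_apply 0) (measurableSet_singleton i)]
  simpa [preimage] using hβ 1 fun _ => i

lemma measurable_block {Λ : Type*} [MeasurableSpace Λ] (a m : ℕ) :
    Measurable fun (ω : ℕ → Λ) (j : Fin m) => ω (a + j) :=
  measurable_pi_lambda _ fun _ => measurable_pi_apply _

section Bernoulli

open ProbabilityTheory

variable {Λ : Type*} [Fintype Λ] [MeasurableSpace Λ] [MeasurableSingletonClass Λ]
  {p : Λ → ℝ} {β : Measure (ℕ → Λ)} [IsProbabilityMeasure β]

lemma bernoulli_eq_infinitePi (hβ : ∀ n : ℕ, ∀ u : Fin n → Λ,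
      β {ω | ∀ j : Fin n, ω (j : ℕ) = u j} = ∏ j : Fin n, ENNReal.ofReal (p (u j))) :
    β = Measure.infinitePi fun _ : ℕ => β.map fun ω => ω 0 := by
  classical
  have hP : IsProbabilityMeasure (β.map fun ω : ℕ → Λ => ω 0) :=
    Measure.isProbabilityMeasure_map (measurable_pi_apply 0).aemeasurable
  refine Measure.eq_infinitePi _ fun s t _ => ?_
  obtain ⟨n, hn⟩ := s.exists_nat_subset_range
  have hres : Measurable fun (ω : ℕ → Λ) (j : Fin n) => ω j :=
    measurable_pi_lambda _ fun j => measurable_pi_apply _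
  have hmap : β.map (fun (ω : ℕ → Λ) (j : Fin n) => ω j) =
      Measure.pi fun _ : Fin n => β.map fun ω => ω 0 := by
    refine Measure.ext_of_singleton fun u => ?_
    rw [Measure.map_apply hres (measurableSet_singleton u), Measure.pi_singleton]
    simp only [bernoulli_coord hβ, ← hβ n u]
    congr 1
    ext ω
    simp [funext_iff]
  have hpre : (s : Set ℕ).pi t = (fun (ω : ℕ → Λ) (j : Fin n) => ω j) ⁻¹'
      Set.pi univ fun j : Fin n => if (j : ℕ) ∈ s then t j else univ := by
    ext ω
    simp only [Set.mem_pi, Finset.mem_coe, mem_preimage, mem_univ, true_imp_iff]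
    constructor
    · intro h j
      split_ifs with hj
      · exact h _ hj
      · trivial
    · intro h i hi
      have := h ⟨i, Finset.mem_range.1 (hn hi)⟩
      rwa [if_pos hi] at this
  rw [hpre, ← Measure.map_apply hres (Set.toFinite _).measurableSet, hmap, Measure.pi_pi,
    Fin.prod_univ_eq_prod_range
      (fun j => β.map (fun ω : ℕ → Λ => ω 0) (if j ∈ s then t j else univ)) n,
    ← Finset.prod_subset hn fun j _ hj => by rw [if_neg hj]; exact measure_univ]
  exact Finset.prod_congr rfl fun j hj => by rw [if_pos hj]

lemma bernoulli_iIndepFun (hβ : ∀ n : ℕ, ∀ u : Fin n → Λ,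
      β {ω | ∀ j : Fin n, ω (j : ℕ) = u j} = ∏ j : Fin n, ENNReal.ofReal (p (u j))) :
    iIndepFun (fun (i : ℕ) (ω : ℕ → Λ) => ω i) β := by
  have hP : IsProbabilityMeasure (β.map fun ω : ℕ → Λ => ω 0) :=
    Measure.isProbabilityMeasure_map (measurable_pi_apply 0).aemeasurable
  rw [bernoulli_eq_infinitePi hβ]
  exact iIndepFun_infinitePi (X := fun _ => id) fun _ => measurable_id

lemma bernoulli_map_block (hβ : ∀ n : ℕ, ∀ u : Fin n → Λ,
      β {ω | ∀ j : Fin n, ω (j : ℕ) = u j} = ∏ j : Fin n, ENNReal.ofReal (p (u j))) (a m : ℕ) :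
    β.map (fun (ω : ℕ → Λ) (j : Fin m) => ω (a + j)) =
      Measure.pi fun _ : Fin m => β.map fun ω => ω 0 := by
  have hP : IsProbabilityMeasure (β.map fun ω : ℕ → Λ => ω 0) :=
    Measure.isProbabilityMeasure_map (measurable_pi_apply 0).aemeasurable
  have hcoord : ∀ i : ℕ, β.map (fun ω => ω i) = β.map fun ω => ω 0 := fun i => by
    conv_lhs => rw [bernoulli_eq_infinitePi hβ]
    exact Measure.infinitePi_map_eval _ i
  have hind := (bernoulli_iIndepFun hβ).precomp (g := fun j : Fin m => a + (j : ℕ))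
    fun i j hij => Fin.ext (Nat.add_left_cancel hij)
  rw [(iIndepFun_iff_map_fun_eq_pi_map fun j => (measurable_pi_apply _).aemeasurable).1 hind]
  simp only [hcoord]

/-- Strong law of large numbers for functions of consecutive disjoint blocks. -/
lemma bernoulli_strong_law_blocks (hp : ∀ i, 0 < p i) (hβ : ∀ n : ℕ, ∀ u : Fin n → Λ,
      β {ω | ∀ j : Fin n, ω (j : ℕ) = u j} = ∏ j : Fin n, ENNReal.ofReal (p (u j)))
    (m : ℕ) (F : List Λ → ℝ) :
    ∀ᵐ ω ∂β, Tendsto (fun q : ℕ => (∑ k ∈ Finset.range q, F (window ω (k * m) m)) / q) atTop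
      (𝓝 (∑ u : Fin m → Λ, (∏ j, p (u j)) * F (List.ofFn u))) := by
  classical
  have hG : Measurable fun u : Fin m → Λ => F (List.ofFn u) := Measurable.of_discrete
  have hmeas : ∀ a, Measurable fun ω : ℕ → Λ => F (window ω a m) := fun a =>
    hG.comp (measurable_block a m)
  have hP : IsProbabilityMeasure (β.map fun ω : ℕ → Λ => ω 0) :=
    Measure.isProbabilityMeasure_map (measurable_pi_apply 0).aemeasurable
  have hintG : Integrable (fun u : Fin m → Λ => F (List.ofFn u))
      (Measure.pi fun _ : Fin m => β.map fun ω => ω 0) := Integrable.of_finite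
  have hident : ∀ a, IdentDistrib (fun ω => F (window ω a m)) (fun ω => F (window ω 0 m)) β β :=
    fun a => IdentDistrib.comp (u := fun u : Fin m → Λ => F (List.ofFn u))
      ⟨(measurable_block a m).aemeasurable, (measurable_block 0 m).aemeasurable, by
        rw [bernoulli_map_block hβ, bernoulli_map_block hβ]⟩ hG
  have hindep : ∀ a b, a + m ≤ b →
      IndepFun (fun ω => F (window ω a m)) (fun ω => F (window ω b m)) β := fun a b hab => by
    have := (bernoulli_iIndepFun hβ).indepFun_finset (Finset.Ico a (a + m))
      (Finset.Ico b (b + m)) (Finset.disjoint_left.2 fun x hx hx' => by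
        rw [Finset.mem_Ico] at hx hx'; omega) fun i => measurable_pi_apply i
    exact this.comp
      (φ := fun v => F (List.ofFn fun j : Fin m => v ⟨a + j, by simp⟩))
      (ψ := fun v => F (List.ofFn fun j : Fin m => v ⟨b + j, by simp⟩))
      Measurable.of_discrete Measurable.of_discrete
  have hlaw := strong_law_ae_real (μ := β) (fun k ω => F (window ω (k * m) m))
    (by
      have := (integrable_map_measure (hG.aestronglyMeasurable)
        (measurable_block 0 m).aemeasurable (μ := β)).1
          ((bernoulli_map_block hβ 0 m).symm ▸ hintG)
      simpa [window, Function.comp_def] using this)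
    (fun k l hkl => by
      rcases lt_or_gt_of_ne hkl with h | h
      · exact hindep _ _ (by nlinarith)
      · exact (hindep _ _ (by nlinarith)).symm)
    (fun k => by simpa using hident (k * m))
  have hmean : ∫ ω, F (window ω (0 * m) m) ∂β =
      ∑ u : Fin m → Λ, (∏ j, p (u j)) * F (List.ofFn u) := by
    have h₁ := integral_map (μ := β) (measurable_block 0 m).aemeasurable
      (f := fun u : Fin m → Λ => F (List.ofFn u)) hG.aestronglyMeasurable
    rw [bernoulli_map_block hβ, integral_fintype hintG] at h₁
    rw [zero_mul]
    refine h₁.symm.trans (Finset.sum_congr rfl fun u _ => ?_)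
    rw [Measure.real, Measure.pi_singleton, ENNReal.toReal_prod, smul_eq_mul]
    simp only [bernoulli_coord hβ, ENNReal.toReal_ofReal (hp _).le]
  rw [hmean] at hlaw
  exact hlaw

end Bernoulli

lemma window_zero {Λ : Type*} (ω : ℕ → Λ) (n : ℕ) :
    window ω 0 n = List.ofFn fun j : Fin n => ω (j : ℕ) := by
  simp [window]

namespace BoundedDistortion

lemma abs_compWord_blocks_sub_le {Λ : Type*} {φ ℓ : Λ → ℝ → ℝ} {ρ K : ℝ}
    (h : BoundedDistortion φ ℓ ρ K) {μ : Measure ℝ} [IsProbabilityMeasure μ]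
    (hμI : μ unitIᶜ = 0) (ω : ℕ → Λ) (m q : ℕ) {y z : ℝ}
    (hy : y ∈ unitI) (hz : z ∈ unitI) :
    |compWord φ (window ω 0 (q * m)) y - compWord φ (window ω 0 (q * m)) z| ≤
      Real.exp (∑ k ∈ Finset.range q,
        (∫ w, logDerivWord φ ℓ (window ω (k * m) m) w ∂μ + 2 * (K / (1 - ρ)))) * |y - z| := by
  induction q generalizing y z with
  | zero => simp [window, compWord]
  | succ q ih =>
    rw [Nat.succ_mul, window_append, compWord_append, compWord_append, zero_add]
    refine (ih (h.compWord_mem _ hy) (h.compWord_mem _ hz)).trans ?_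
    rw [Finset.sum_range_succ, Real.exp_add, mul_assoc]
    exact mul_le_mul_of_nonneg_left (h.abs_compWord_sub_le_exp_integral hμI _ hy hz)
      (Real.exp_pos _).le

/-- Cylinder images shrink almost surely at least at the rate given by the mean log-derivative. -/
lemma ae_eventually_abs_compWord_sub_le {Λ : Type*} [Fintype Λ] [MeasurableSpace Λ]
    [MeasurableSingletonClass Λ] {φ ℓ : Λ → ℝ → ℝ} {ρ K : ℝ}
    (h : BoundedDistortion φ ℓ ρ K) {p : Λ → ℝ} (hp : ∀ i, 0 < p i) (hp1 : ∑ i, p i = 1)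
    {μ : Measure ℝ} [IsProbabilityMeasure μ] (hμI : μ unitIᶜ = 0)
    (hμ : μ = ∑ i : Λ, ENNReal.ofReal (p i) • Measure.map (φ i) μ)
    {β : Measure (ℕ → Λ)} [IsProbabilityMeasure β]
    (hβ : ∀ n : ℕ, ∀ u : Fin n → Λ,
      β {ω | ∀ j : Fin n, ω (j : ℕ) = u j} = ∏ j : Fin n, ENNReal.ofReal (p (u j)))
    {ε : ℝ} (hε : 0 < ε) :
    ∀ᵐ ω ∂β, ∀ᶠ n : ℕ in atTop, ∀ y ∈ unitI, ∀ z ∈ unitI,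
      |compWord φ (window ω 0 n) y - compWord φ (window ω 0 n) z| ≤
        Real.exp (((∑ i, p i * ∫ w, ℓ i w ∂μ) + ε) * n) := by
  set L := ∑ i, p i * ∫ w, ℓ i w ∂μ with hL
  set C := K / (1 - ρ) with hC
  obtain ⟨m, hm⟩ := exists_nat_gt (8 * C / ε)
  have hC0 : 0 ≤ C := div_nonneg h.lip_nonneg (sub_pos.2 h.rate_lt_one).le
  have hm0 : (0 : ℝ) < m := lt_of_le_of_lt (by positivity) hm
  have hm0' : 0 < m := by exact_mod_cast hm0
  have hmC : 8 * C < m * ε := (div_lt_iff₀ hε).1 hm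
  have hlaw := bernoulli_strong_law_blocks hp hβ m fun u => ∫ w, logDerivWord φ ℓ u w ∂μ
  rw [sum_integral_logDerivWord h hp hp1 hμI hμ m, ← hL] at hlaw
  filter_upwards [hlaw] with ω hω
  have h₁ : ∀ᶠ q : ℕ in atTop, (∑ k ∈ Finset.range q,
      ∫ w, logDerivWord φ ℓ (window ω (k * m) m) w ∂μ) / q < m * L + m * ε / 4 :=
    hω.eventually_lt_const (by have := mul_pos hm0 hε; linarith)
  have h₂ := (Nat.tendsto_div_const_atTop hm0'.ne').eventually
    (h₁.and (eventually_gt_atTop 0))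
  have h₃ : ∀ᶠ n : ℕ in atTop, m * |L + ε / 2| ≤ n * (ε / 2) :=
    (tendsto_natCast_atTop_atTop.atTop_mul_const (half_pos hε)).eventually_ge_atTop _
  filter_upwards [h₂, h₃] with n ⟨hn, hq⟩ hn' y hy z hz
  set q := n / m with hqdef
  have hq0 : (0 : ℝ) < q := by exact_mod_cast hq
  rw [div_lt_iff₀ hq0] at hn
  have hdecomp : n = q * m + n % m := by rw [hqdef, mul_comm]; exact (Nat.div_add_mod n m).symm
  have hr : ((n % m : ℕ) : ℝ) ≤ m := by exact_mod_cast (Nat.mod_lt n hm0').le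
  have hr0 : (0 : ℝ) ≤ ((n % m : ℕ) : ℝ) := Nat.cast_nonneg _
  have hdecomp' : (n : ℝ) = q * m + ((n % m : ℕ) : ℝ) := by exact_mod_cast hdecomp
  have hw : window ω 0 n = window ω 0 (q * m) ++ window ω (0 + q * m) (n % m) := by
    rw [← window_append, ← hdecomp]
  rw [hw, compWord_append, compWord_append]
  refine (h.abs_compWord_blocks_sub_le hμI ω m q (h.compWord_mem _ hy)
    (h.compWord_mem _ hz)).trans ((mul_le_of_le_one_right (Real.exp_pos _).le
      (abs_sub_le_one (h.compWord_mem _ hy) (h.compWord_mem _ hz))).trans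
        (Real.exp_le_exp.2 ?_))
  rw [Finset.sum_add_distrib, Finset.sum_const, Finset.card_range, nsmul_eq_mul]
  have h₄ : -(((n % m : ℕ) : ℝ) * (L + ε / 2)) ≤ m * |L + ε / 2| := by
    rw [← mul_neg]
    exact (mul_le_mul_of_nonneg_left (neg_le_abs _) hr0).trans
      (mul_le_mul_of_nonneg_right hr (abs_nonneg _))
  have h₅ : (q : ℝ) * (2 * C) ≤ q * (m * ε / 4) := by gcongr; linarith
  have h₆ : (q : ℝ) * m = n - ((n % m : ℕ) : ℝ) := by linarith
  have h₇ : (m * L + m * ε / 4) * q + q * (m * ε / 4) = (q * m) * (L + ε / 2) := by ring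
  rw [h₆] at h₇
  linarith

lemma abs_compWord_sub_le_of_tendsto {Λ : Type*} {φ ℓ : Λ → ℝ → ℝ} {ρ K : ℝ}
    (h : BoundedDistortion φ ℓ ρ K) {ω : ℕ → Λ} {x r : ℝ} {n : ℕ}
    (hx : Tendsto (fun n : ℕ => compWord φ (window ω 0 n) 0) atTop (𝓝 x))
    (hr : ∀ y ∈ unitI, ∀ z ∈ unitI,
      |compWord φ (window ω 0 n) y - compWord φ (window ω 0 n) z| ≤ r)
    {y : ℝ} (hy : y ∈ unitI) : |compWord φ (window ω 0 n) y - x| ≤ r := by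
  refine le_of_tendsto (tendsto_const_nhds.sub hx).abs ?_
  filter_upwards [eventually_ge_atTop n] with N hN
  obtain ⟨k, rfl⟩ := Nat.exists_eq_add_of_le hN
  rw [window_append ω 0 n k, compWord_append]
  exact hr y hy _ (h.compWord_mem _ (by simp [unitI]))

lemma aemeasurable_compWord_prod {Λ : Type*} [Fintype Λ] [MeasurableSpace Λ]
    [MeasurableSingletonClass Λ] {φ ℓ : Λ → ℝ → ℝ} {ρ K : ℝ}
    (h : BoundedDistortion φ ℓ ρ K) {μ : Measure ℝ} [IsProbabilityMeasure μ]
    (hμI : μ unitIᶜ = 0) (ν : Measure (ℕ → Λ)) [IsProbabilityMeasure ν] (n : ℕ) :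
    AEMeasurable (fun q : (ℕ → Λ) × ℝ => compWord φ (window q.1 0 n) q.2) (ν.prod μ) := by
  have hclamp : ∀ y : ℝ, max 0 (min 1 y) ∈ unitI := fun y =>
    ⟨le_max_left _ _, max_le zero_le_one (min_le_left _ _)⟩
  have hG : Measurable fun q : (Fin n → Λ) × ℝ =>
      compWord φ (List.ofFn q.1) (max 0 (min 1 q.2)) :=
    measurable_from_prod_countable_right fun u =>
      ((h.continuousOn_compWord (List.ofFn u)).comp_continuous
        (f := fun y : ℝ => max 0 (min 1 y)) (by fun_prop) hclamp).measurable
  refine ⟨_, hG.comp ((measurable_block 0 n).prodMap measurable_id), ?_⟩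
  have hI : ∀ᵐ y ∂μ, y ∈ unitI := hμI
  filter_upwards [Measure.quasiMeasurePreserving_snd.ae hI] with q hq
  change _ = compWord φ (window q.1 0 n) (max 0 (min 1 q.2))
  rw [min_eq_right hq.2, max_eq_right hq.1]

end BoundedDistortion

lemma neg_mul_logb_le {q v : ℝ} (hq : 0 ≤ q) (hv : 0 < v) :
    -(q * Real.logb 2 q) ≤ q * Real.logb 2 v + (1 / v - q) / Real.log 2 := by
  have h2 : 0 < Real.log 2 := Real.log_pos one_lt_two
  rcases hq.eq_or_lt with rfl | hq
  · simp only [zero_mul, neg_zero, zero_add, sub_zero]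
    positivity
  · have h₁ := Real.log_le_sub_one_of_pos (x := 1 / (q * v)) (by positivity)
    rw [one_div, Real.log_inv, Real.log_mul hq.ne' hv.ne'] at h₁
    have h₂ := mul_le_mul_of_nonneg_left h₁ hq.le
    have h₃ : q * ((q * v)⁻¹ - 1) = 1 / v - q := by field_simp
    rw [h₃] at h₂
    rw [Real.logb, Real.logb, ← sub_nonneg]
    have h₄ : q * (Real.log v / Real.log 2) + (1 / v - q) / Real.log 2 -
        -(q * (Real.log q / Real.log 2)) =
        ((1 / v - q) - q * -(Real.log q + Real.log v)) / Real.log 2 := by field_simp; ring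
    rw [h₄]
    exact div_nonneg (sub_nonneg.2 h₂) h2.le

lemma mem_dyadIco_iff {N : ℕ} {m : ℤ} {y : ℝ} : y ∈ dyadIco N m ↔ ⌊y * 2 ^ N⌋ = m := by
  have h2 : (0 : ℝ) < 2 ^ N := by positivity
  rw [dyadIco, mem_Ico, div_le_iff₀ h2, lt_div_iff₀ h2, Int.floor_eq_iff]

lemma sum_measureReal_dyadIco {N : ℕ} (θ : Measure ℝ) [IsFiniteMeasure θ] (U : Finset ℤ) :
    ∑ m ∈ U, θ.real (dyadIco N m) = θ.real (⋃ m ∈ U, dyadIco N m) := by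
  refine (measureReal_biUnion_finset (fun m _ k _ hmk => ?_) fun m _ => measurableSet_Ico).symm
  refine Set.disjoint_left.2 fun y hy hy' => hmk ?_
  rw [← mem_dyadIco_iff.1 hy, ← mem_dyadIco_iff.1 hy']

lemma ent1_nonneg (N : ℕ) (θ : Measure ℝ) [IsProbabilityMeasure θ] : 0 ≤ ent1 N θ := by
  refine neg_nonneg.2 (tsum_nonpos fun m => mul_nonpos_of_nonneg_of_nonpos measureReal_nonneg ?_)
  exact Real.logb_nonpos one_lt_two measureReal_nonneg measureReal_le_one

/-- A measure on `I` giving mass at least `1 - δ` to an interval of radius `r` has small entropy. -/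
lemma ent1_le (N : ℕ) (θ : Measure ℝ) [IsProbabilityMeasure θ] (hθ : θ unitIᶜ = 0)
    {x r δ : ℝ} (hr : 0 ≤ r) (hδ : θ.real (closedBall x r)ᶜ ≤ δ) :
    ent1 N θ ≤ 1 + Real.logb 2 (2 * r * 2 ^ N + 2) + δ * (N + 2) := by
  classical
  have h2 : (0 : ℝ) < 2 ^ N := by positivity
  have hlog2 : 0 < Real.log 2 := Real.log_pos one_lt_two
  set a : ℝ := 2 * r * 2 ^ N + 2 with ha
  have ha2 : 2 ≤ a := by rw [ha]; linarith [mul_nonneg hr h2.le]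
  have ha0 : 0 < a := by linarith
  set S : Finset ℤ := Finset.Icc 0 (2 ^ N) with hS
  set T : Finset ℤ := Finset.Icc ⌊(x - r) * 2 ^ N⌋ ⌊(x + r) * 2 ^ N⌋ with hT
  have hIS : ∀ y ∈ unitI, ⌊y * 2 ^ N⌋ ∈ S := fun y hy => by
    rw [hS, Finset.mem_Icc, Int.floor_nonneg]
    refine ⟨mul_nonneg hy.1 h2.le, ?_⟩
    have : ⌊y * 2 ^ N⌋ ≤ ⌊(((2 ^ N : ℤ)) : ℝ)⌋ := Int.floor_mono (by
      push_cast
      exact mul_le_of_le_one_left h2.le hy.2)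
    rwa [Int.floor_intCast] at this
  have hBT : ∀ y ∈ closedBall x r, ⌊y * 2 ^ N⌋ ∈ T := fun y hy => by
    rw [Real.closedBall_eq_Icc] at hy
    rw [hT, Finset.mem_Icc]
    exact ⟨Int.floor_mono (mul_le_mul_of_nonneg_right hy.1 h2.le),
      Int.floor_mono (mul_le_mul_of_nonneg_right hy.2 h2.le)⟩
  have hcardT : (T.card : ℝ) ≤ a := by
    have h₁ : ⌊(x - r) * 2 ^ N⌋ ≤ ⌊(x + r) * 2 ^ N⌋ :=
      Int.floor_mono (mul_le_mul_of_nonneg_right (by linarith) h2.le)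
    have h₂ : ((T.card : ℤ) : ℝ) = ⌊(x + r) * 2 ^ N⌋ + 1 - ⌊(x - r) * 2 ^ N⌋ := by
      rw [hT, Int.card_Icc, Int.toNat_of_nonneg (by omega)]
      push_cast
      rfl
    rw [Int.cast_natCast] at h₂
    have h₃ := Int.floor_le ((x + r) * 2 ^ N)
    have h₄ := Int.sub_one_lt_floor ((x - r) * 2 ^ N)
    rw [h₂, ha]
    linarith
  have hcardS : (S.card : ℝ) ≤ 2 ^ (N + 1) := by
    have h₁ : S.card = 2 ^ N + 1 := by
      have : ((2 : ℤ) ^ N + 1 - 0).toNat = 2 ^ N + 1 := by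
        have : ((2 : ℤ) ^ N + 1 - 0) = ((2 ^ N + 1 : ℕ) : ℤ) := by push_cast; ring
        rw [this, Int.toNat_natCast]
      rw [hS, Int.card_Icc, this]
    rw [h₁, pow_succ]
    push_cast
    linarith [one_le_pow₀ (M₀ := ℝ) one_le_two (n := N)]
  set q : ℤ → ℝ := fun m => θ.real (dyadIco N m) with hq
  have hsupp : ∀ m ∉ T ∪ S \ T, q m * Real.logb 2 (q m) = 0 := fun m hm => by
    have hmS : m ∉ S := fun h => hm (by
      rw [Finset.union_sdiff_self_eq_union]; exact Finset.mem_union_right _ h)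
    have : q m = 0 := by
      rw [hq, measureReal_eq_zero_iff]
      refine measure_mono_null (t := unitIᶜ) (fun y hy hyI => hmS ?_) hθ
      rw [← mem_dyadIco_iff.1 hy]
      exact hIS y hyI
    rw [this, zero_mul]
  have hent : ent1 N θ = ∑ m ∈ T, -(q m * Real.logb 2 (q m)) +
      ∑ m ∈ S \ T, -(q m * Real.logb 2 (q m)) := by
    rw [← Finset.sum_union Finset.disjoint_sdiff, Finset.sum_neg_distrib,
      ← tsum_eq_sum (L := SummationFilter.unconditional ℤ) hsupp]
    rfl
  have hqT : ∑ m ∈ T, q m ≤ 1 := by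
    rw [sum_measureReal_dyadIco]; exact measureReal_le_one
  have hqS : ∑ m ∈ S \ T, q m ≤ δ := by
    rw [sum_measureReal_dyadIco]
    refine (measureReal_mono fun y hy hyB => ?_).trans hδ
    obtain ⟨m, hm, hym⟩ := mem_iUnion₂.1 hy
    rw [← mem_dyadIco_iff.1 hym] at hm
    exact (Finset.mem_sdiff.1 hm).2 (hBT y hyB)
  have hθ1 : θ.real unitI = 1 := by
    rw [Measure.real, (prob_compl_eq_zero_iff
      (by exact measurableSet_Icc : MeasurableSet unitI)).1 hθ, ENNReal.toReal_one]
  have hq1 : 1 ≤ ∑ m ∈ T, q m + ∑ m ∈ S \ T, q m := by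
    rw [← Finset.sum_union Finset.disjoint_sdiff, sum_measureReal_dyadIco,
      Finset.union_sdiff_self_eq_union, ← hθ1]
    refine measureReal_mono (fun y hy => mem_iUnion₂.2 ⟨_, ?_, mem_dyadIco_iff.2 rfl⟩)
      (measure_ne_top _ _)
    exact Finset.mem_union_right _ (hIS y hy)
  have hboundT : ∑ m ∈ T, -(q m * Real.logb 2 (q m)) ≤
      (∑ m ∈ T, q m) * Real.logb 2 (2 * a) + (1 / 2 - ∑ m ∈ T, q m) / Real.log 2 := by
    refine (Finset.sum_le_sum fun m _ => neg_mul_logb_le (v := 2 * a) measureReal_nonneg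
      (by positivity)).trans ?_
    rw [Finset.sum_add_distrib, ← Finset.sum_mul, ← Finset.sum_div, Finset.sum_sub_distrib,
      Finset.sum_const, nsmul_eq_mul]
    gcongr
    rw [mul_one_div, div_le_iff₀ (by positivity)]
    linarith
  have hboundS : ∑ m ∈ S \ T, -(q m * Real.logb 2 (q m)) ≤
      (∑ m ∈ S \ T, q m) * Real.logb 2 (2 ^ (N + 2)) +
        (1 / 2 - ∑ m ∈ S \ T, q m) / Real.log 2 := by
    refine (Finset.sum_le_sum fun m _ => neg_mul_logb_le (v := 2 ^ (N + 2)) measureReal_nonneg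
      (by positivity)).trans ?_
    rw [Finset.sum_add_distrib, ← Finset.sum_mul, ← Finset.sum_div, Finset.sum_sub_distrib,
      Finset.sum_const, nsmul_eq_mul]
    gcongr
    have h₁ : ((S \ T).card : ℝ) ≤ S.card := by
      exact_mod_cast Finset.card_le_card Finset.sdiff_subset
    rw [mul_one_div, div_le_iff₀ (by positivity), pow_succ]
    linarith
  have hlogS : Real.logb 2 (2 ^ (N + 2)) = N + 2 := by
    rw [Real.logb_pow, Real.logb_self_eq_one one_lt_two]
    push_cast
    ring
  have hlogT : Real.logb 2 (2 * a) = 1 + Real.logb 2 a := by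
    rw [Real.logb_mul two_ne_zero ha0.ne', Real.logb_self_eq_one one_lt_two]
  have hloga : 0 ≤ Real.logb 2 a := Real.logb_nonneg one_lt_two (by linarith)
  rw [hlogT] at hboundT
  rw [hlogS] at hboundS
  have h₁ : (1 / 2 - ∑ m ∈ T, q m) / Real.log 2 + (1 / 2 - ∑ m ∈ S \ T, q m) / Real.log 2 ≤ 0 := by
    rw [← add_div]
    exact div_nonpos_of_nonpos_of_nonneg (by linarith) hlog2.le
  have h₂ : (∑ m ∈ T, q m) * (1 + Real.logb 2 a) ≤ 1 + Real.logb 2 a :=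
    mul_le_of_le_one_left (by linarith) hqT
  have h₃ : (∑ m ∈ S \ T, q m) * ((N : ℝ) + 2) ≤ δ * (N + 2) :=
    mul_le_mul_of_nonneg_right hqS (by positivity)
  rw [hent]
  linarith

lemma tendsto_measureReal_compl_zero {Ω : Type*} [MeasurableSpace Ω] {ν : Measure Ω}
    [IsProbabilityMeasure ν] {G : ℕ → Set Ω} (hG : ∀ n, MeasurableSet (G n))
    (h : ∀ᵐ η ∂ν, ∀ᶠ n in atTop, η ∈ G n) :
    Tendsto (fun n => ν.real (G n)ᶜ) atTop (𝓝 0) := by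
  have h₁ := tendsto_measure_of_ae_tendsto_indicator (μ := ν) (As := fun n => (G n)ᶜ) (A := ∅)
    (B := univ) atTop MeasurableSet.empty (fun n => (hG n).compl) MeasurableSet.univ
    (measure_ne_top _ _) (Eventually.of_forall fun _ => subset_univ _) (by
      filter_upwards [h] with η hη
      filter_upwards [hη] with n hn
      simpa using hn)
  rw [measure_empty] at h₁
  exact (ENNReal.tendsto_toReal ENNReal.zero_ne_top).comp h₁

lemma measurableSet_setOf_window {Λ : Type*} [Finite Λ] [MeasurableSpace Λ]
    [MeasurableSingletonClass Λ] (P : List Λ → Prop) (n : ℕ) :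
    MeasurableSet {η : ℕ → Λ | P (window η 0 n)} :=
  measurable_block 0 n
    (Set.toFinite {u : Fin n → Λ | P (List.ofFn u)}).measurableSet

lemma measurable_coding {Λ : Type*} [Finite Λ] [MeasurableSpace Λ] [MeasurableSingletonClass Λ]
    (φ : Λ → ℝ → ℝ) {Pi : (ℕ → Λ) → ℝ}
    (hPi : ∀ ω, Tendsto (fun n : ℕ => compWord φ (window ω 0 n) 0) atTop (𝓝 (Pi ω))) :
    Measurable Pi := by
  refine measurable_of_tendsto_metrizable (fun n => ?_) (tendsto_pi_nhds.2 hPi)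
  have : Measurable fun u : Fin n → Λ => compWord φ (List.ofFn u) 0 := Measurable.of_discrete
  exact this.comp (measurable_block 0 n)

/-- An almost sure property holds almost surely for almost every conditional measure. -/
lemma ae_ae_of_disintegration {Ω : Type*} [MeasurableSpace Ω] {β : Measure Ω}
    {κ : Ω → Measure Ω} (hmeas : ∀ B, MeasurableSet B → Measurable fun ω => κ ω B)
    (hint : ∀ B, MeasurableSet B → ∫⁻ ω, κ ω B ∂β = β B) {P : Ω → Prop} (hP : ∀ᵐ η ∂β, P η) :
    ∀ᵐ ω ∂β, ∀ᵐ η ∂κ ω, P η := by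
  obtain ⟨N, hPN, hN, hN0⟩ := exists_measurable_superset_of_null hP
  have h₁ := hint N hN
  rw [hN0, lintegral_eq_zero_iff (hmeas N hN)] at h₁
  filter_upwards [h₁] with ω hω
  exact measure_mono_null hPN hω

section Limit

variable {Λ : Type*} [Fintype Λ] [MeasurableSpace Λ] [MeasurableSingletonClass Λ]
  {φ ℓ : Λ → ℝ → ℝ} {ρ K : ℝ} {μ : Measure ℝ} [IsProbabilityMeasure μ]
  {ν : Measure (ℕ → Λ)} [IsProbabilityMeasure ν]

lemma ent1_map_le (h : BoundedDistortion φ ℓ ρ K) (hμI : μ unitIᶜ = 0) (N n : ℕ) {x r : ℝ}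
    (hr : 0 ≤ r) :
    0 ≤ ent1 N ((ν.prod μ).map fun q => compWord φ (window q.1 0 n) q.2) ∧
    ent1 N ((ν.prod μ).map fun q => compWord φ (window q.1 0 n) q.2) ≤
      1 + Real.logb 2 (2 * r * 2 ^ N + 2) +
        ν.real {η | ∀ y ∈ unitI, |compWord φ (window η 0 n) y - x| ≤ r}ᶜ * (N + 2) := by
  set G : Set (ℕ → Λ) := {η | ∀ y ∈ unitI, |compWord φ (window η 0 n) y - x| ≤ r} with hG
  have hF := h.aemeasurable_compWord_prod hμI ν n
  have hθ := Measure.isProbabilityMeasure_map hF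
  have hI : ∀ᵐ q ∂ν.prod μ, q.2 ∈ unitI :=
    Measure.quasiMeasurePreserving_snd.ae (show ∀ᵐ y ∂μ, y ∈ unitI from hμI)
  refine ⟨ent1_nonneg N _, ent1_le N _ ?_ hr (x := x) ?_⟩
  · rw [Measure.map_apply_of_aemeasurable hF
      (by exact measurableSet_Icc.compl : MeasurableSet unitIᶜ)]
    refine measure_mono_null (t := {q : (ℕ → Λ) × ℝ | q.2 ∈ unitI}ᶜ) (fun q hq hqI => ?_) hI
    exact hq (h.compWord_mem _ hqI)
  · have h₁ : (ν.prod μ) ((fun q => compWord φ (window q.1 0 n) q.2) ⁻¹' (closedBall x r)ᶜ) ≤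
        (ν.prod μ) (Gᶜ ×ˢ univ) := by
      refine measure_mono_ae ?_
      filter_upwards [hI] with q hqI hq
      exact ⟨fun hqG => hq (hqG q.2 hqI), trivial⟩
    rw [Measure.prod_prod, measure_univ, mul_one] at h₁
    rw [Measure.real, Measure.map_apply_of_aemeasurable hF measurableSet_closedBall.compl]
    exact ENNReal.toReal_mono (measure_ne_top _ _) h₁

lemma logb_scale_le {χ ε : ℝ} (hχ : 0 ≤ χ) (hε : 0 < ε) (n : ℕ) :
    Real.logb 2 (2 * Real.exp ((-(χ * Real.log 2) + ε) * n) * 2 ^ ⌊χ * n⌋₊ + 2) ≤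
      2 + ε / Real.log 2 * n := by
  have hlog2 : 0 < Real.log 2 := Real.log_pos one_lt_two
  have h₁ : (2 : ℝ) ^ ⌊χ * n⌋₊ ≤ Real.exp (χ * Real.log 2 * n) := by
    rw [← Real.rpow_natCast, Real.rpow_def_of_pos two_pos, Real.exp_le_exp]
    nlinarith [Nat.floor_le (mul_nonneg hχ (Nat.cast_nonneg (α := ℝ) n))]
  have h₂ : 1 ≤ Real.exp (ε * n) := Real.one_le_exp (by positivity)
  have h₃ : Real.exp ((-(χ * Real.log 2) + ε) * n) * 2 ^ ⌊χ * n⌋₊ ≤ Real.exp (ε * n) := by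
    refine (mul_le_mul_of_nonneg_left h₁ (Real.exp_pos _).le).trans (le_of_eq ?_)
    rw [← Real.exp_add]
    ring_nf
  rw [Real.logb, div_le_iff₀ hlog2, Real.log_le_iff_le_exp (by positivity)]
  have h₄ : (2 + ε / Real.log 2 * n) * Real.log 2 = 2 * Real.log 2 + ε * n := by field_simp
  have h₅ : Real.exp (2 * Real.log 2) = 4 := by
    rw [two_mul, Real.exp_add, Real.exp_log two_pos]
    norm_num
  rw [h₄, Real.exp_add, h₅]
  linarith

/-- If `ν`-almost every cylinder shrinks to `x` at rate `2 ^ (-χ n)`, the scale-`χ n` entropy is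
sublinear. -/
lemma tendsto_ent1_zero (h : BoundedDistortion φ ℓ ρ K) (hμI : μ unitIᶜ = 0)
    {χ x : ℝ} (hχ : 0 ≤ χ)
    (hshrink : ∀ k : ℕ, ∀ᵐ η ∂ν, ∀ᶠ n : ℕ in atTop, ∀ y ∈ unitI,
      |compWord φ (window η 0 n) y - x| ≤
        Real.exp ((-(χ * Real.log 2) + 1 / ((k : ℝ) + 1)) * n)) :
    Tendsto (fun n : ℕ => (1 / (n : ℝ)) * ent1 ⌊χ * (n : ℝ)⌋₊
      ((ν.prod μ).map fun q => compWord φ (window q.1 0 n) q.2)) atTop (𝓝 0) := by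
  have hlog2 : 0 < Real.log 2 := Real.log_pos one_lt_two
  refine tendsto_order.2 ⟨fun a ha => Eventually.of_forall fun n => ?_, fun a ha => ?_⟩
  · exact ha.trans_le (mul_nonneg (by positivity)
      (ent1_map_le h hμI _ n (x := x) zero_le_one).1)
  · obtain ⟨k, hk⟩ := exists_nat_one_div_lt (mul_pos ha hlog2)
    set ε : ℝ := 1 / ((k : ℝ) + 1) with hεdef
    have hε : 0 < ε := Nat.one_div_pos_of_nat
    have hδ := tendsto_measureReal_compl_zero (fun n => measurableSet_setOf_window
      (fun u => ∀ y ∈ unitI, |compWord φ u y - x| ≤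
        Real.exp ((-(χ * Real.log 2) + ε) * n)) n) (hshrink k)
    set δ : ℕ → ℝ := fun n => ν.real {η | ∀ y ∈ unitI, |compWord φ (window η 0 n) y - x| ≤
      Real.exp ((-(χ * Real.log 2) + ε) * n)}ᶜ with hδdef
    have hinv : Tendsto (fun n : ℕ => 1 / (n : ℝ)) atTop (𝓝 0) :=
      tendsto_one_div_atTop_nhds_zero_nat
    have hlim : Tendsto (fun n : ℕ => 3 * (1 / (n : ℝ)) + ε / Real.log 2 +
        δ n * (χ + 2 * (1 / (n : ℝ)))) atTop (𝓝 (ε / Real.log 2)) := by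
      have := ((hinv.const_mul 3).add_const (ε / Real.log 2)).add
        (hδ.mul ((hinv.const_mul 2).const_add χ))
      simpa using this
    filter_upwards [hlim.eventually_lt_const ((div_lt_iff₀ hlog2).2 hk), eventually_gt_atTop 0]
      with n hn hn0
    refine lt_of_le_of_lt ?_ hn
    have hn0' : (0 : ℝ) < n := by exact_mod_cast hn0
    have h₁ := (ent1_map_le (ν := ν) h hμI ⌊χ * (n : ℝ)⌋₊ n (x := x)
      (Real.exp_pos ((-(χ * Real.log 2) + ε) * n)).le).2
    have h₂ := logb_scale_le hχ hε n
    have h₃ : δ n * ((⌊χ * (n : ℝ)⌋₊ : ℝ) + 2) ≤ δ n * (χ * n + 2) :=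
      mul_le_mul_of_nonneg_left (by linarith [Nat.floor_le (mul_nonneg hχ hn0'.le)])
        measureReal_nonneg
    have h₄ : 3 * (1 / (n : ℝ)) + ε / Real.log 2 + δ n * (χ + 2 * (1 / (n : ℝ))) =
        1 / (n : ℝ) * (3 + ε / Real.log 2 * n + δ n * (χ * n + 2)) := by
      field_simp
    rw [h₄]
    refine mul_le_mul_of_nonneg_left ?_ (by positivity)
    linarith

end Limit

theorem zero_entropy_lemma
    {Λ : Type} [Fintype Λ] [Nonempty Λ] [MeasurableSpace Λ] [MeasurableSingletonClass Λ]
    (φ : Λ → ℝ → ℝ)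
    (hanal : ∀ i, AnalyticOnNhd ℝ (φ i) unitI)
    (hmaps : ∀ i, Set.MapsTo (φ i) unitI unitI)
    (hderiv : ∀ i, ∀ x ∈ unitI, 0 < |deriv (φ i) x| ∧ |deriv (φ i) x| < 1)
    (hnofix : ¬ ∃ x ∈ unitI, ∀ i, φ i x = x)
    (p : Λ → ℝ) (hp : ∀ i, 0 < p i) (hp1 : ∑ i, p i = 1)
    (μ : Measure ℝ) (hprob : IsProbabilityMeasure μ) (hμI : μ unitIᶜ = 0)
    (hμ : μ = ∑ i : Λ, ENNReal.ofReal (p i) • Measure.map (φ i) μ)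
    -- the Lyapunov exponent
    (χ : ℝ) (hχ : χ = -∑ i, p i * ∫ x, Real.logb 2 |deriv (φ i) x| ∂μ)
    -- the Bernoulli measure `β = p^ℕ` on `Λ^ℕ`
    (β : Measure (ℕ → Λ)) (hβprob : IsProbabilityMeasure β)
    (hβ : ∀ n : ℕ, ∀ u : Fin n → Λ,
      β {ω | ∀ j : Fin n, ω (j : ℕ) = u j} = ∏ j : Fin n, ENNReal.ofReal (p (u j)))
    -- the coding map `Π`
    (Pi : (ℕ → Λ) → ℝ)
    (hPi : ∀ ω, Tendsto (fun n : ℕ =>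
      compWord φ (List.ofFn fun j : Fin n => ω (j : ℕ)) 0) atTop (nhds (Pi ω)))
    -- `{β_ω}` is the disintegration of `β` with respect to `Π⁻¹(Borel)`
    (bconds : (ℕ → Λ) → Measure (ℕ → Λ))
    (hb_prob : ∀ᵐ ω ∂β, IsProbabilityMeasure (bconds ω))
    (hb_meas : ∀ B : Set (ℕ → Λ), MeasurableSet B → Measurable fun ω => bconds ω B)
    (hb_factor : ∀ ω ω', Pi ω = Pi ω' → bconds ω = bconds ω')
    (hb_fiber : ∀ᵐ ω ∂β, bconds ω (Pi ⁻¹' {Pi ω}) = 1)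
    (hb_int : ∀ B : Set (ℕ → Λ), MeasurableSet B → ∫⁻ ω, bconds ω B ∂β = β B) :
    ∀ᵐ ω ∂β, Tendsto (fun n : ℕ => (1 / (n : ℝ)) * ent1 ⌊χ * (n : ℝ)⌋₊
        (((bconds ω).prod μ).map fun q =>
          compWord φ (List.ofFn fun j : Fin n => q.1 (j : ℕ)) q.2))
      atTop (nhds 0) := by
  obtain ⟨ρ, K, h⟩ := exists_boundedDistortion φ hanal hmaps hderiv
  have hlog2 : 0 < Real.log 2 := Real.log_pos one_lt_two
  have hμI' : ∀ᵐ x ∂μ, x ∈ unitI := hμI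
  simp only [← window_zero] at hPi ⊢
  have hL : ∑ i, p i * ∫ x, Real.log |deriv (φ i) x| ∂μ = -(χ * Real.log 2) := by
    simp only [hχ, Real.logb, integral_div, neg_mul, neg_neg, Finset.sum_mul]
    exact Finset.sum_congr rfl fun i _ => by field_simp
  have hχ0 : 0 ≤ χ := by
    rw [hχ, neg_nonneg]
    refine Finset.sum_nonpos fun i _ => mul_nonpos_of_nonneg_of_nonpos (hp i).le
      (integral_nonpos_of_ae ?_)
    filter_upwards [hμI'] with x hx
    exact Real.logb_nonpos one_lt_two (abs_nonneg _) (hderiv i x hx).2.le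
  have hshrink : ∀ k : ℕ, ∀ᵐ η ∂β, ∀ᶠ n : ℕ in atTop, ∀ y ∈ unitI,
      |compWord φ (window η 0 n) y - Pi η| ≤
        Real.exp ((-(χ * Real.log 2) + 1 / ((k : ℝ) + 1)) * n) := fun k => by
    have hk := h.ae_eventually_abs_compWord_sub_le hp hp1 hμI hμ hβ
      (Nat.one_div_pos_of_nat (α := ℝ) (n := k))
    rw [hL] at hk
    filter_upwards [hk] with η hη
    filter_upwards [hη] with n hn y hy
    exact h.abs_compWord_sub_le_of_tendsto (hPi η) hn hy
  have hdis := ae_ae_of_disintegration hb_meas hb_int (ae_all_iff.2 hshrink)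
  filter_upwards [hb_prob, hb_fiber, hdis] with ω hprobω hfiber hω
  have hfib : ∀ᵐ η ∂bconds ω, Pi η = Pi ω :=
    (prob_compl_eq_zero_iff (measurable_coding φ hPi (measurableSet_singleton (Pi ω)))).2 hfiber
  refine tendsto_ent1_zero h hμI (x := Pi ω) hχ0 fun k => ?_
  filter_upwards [hω, hfib] with η hη hηω
  rw [← hηω]
  exact hη k
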